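/- Let (X, m) be a standard Borel probability space equipped with an ergodic measure-preserving flow (T_t)_{t∈ℝ}. Then the set {t ∈ ℝ : the map T_t is ergodic with respect to m} is uncountable. -/

import Mathlib

open MeasureTheory Filter Topology
open scoped InnerProductSpace

/-- In a separable inner product space, a pairwise orthogonal family of nonzero vectors has a
countable index set. -/
theorem countable_of_pairwise_orthogonal {E ι : Type*} [NormedAddCommGroup E]
    [InnerProductSpace ℂ E] [TopologicalSpace.SeparableSpace E] {S : Set ι} {v : ι → E}
    (h0 : ∀ i ∈ S, v i ≠ 0) (hv : ∀ i ∈ S, ∀ j ∈ S, i ≠ j → ⟪v i, v j⟫_ℂ = 0) :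
    S.Countable := by
  have hd : S.PairwiseDisjoint fun i => Metric.ball (v i) (‖v i‖ / 2) := by
    intro i hi j hj hij
    refine Metric.ball_disjoint_ball ?_
    have h1 : ‖v i - v j‖ * ‖v i - v j‖ = ‖v i‖ * ‖v i‖ + ‖v j‖ * ‖v j‖ := by
      rw [← sub_zero (‖v i‖ * ‖v i‖ + ‖v j‖ * ‖v j‖), @norm_sub_mul_self ℂ, hv i hi j hj hij]
      simp
    rw [dist_eq_norm]
    nlinarith [norm_nonneg (v i), norm_nonneg (v j), norm_nonneg (v i - v j),
      sq_nonneg (‖v i‖ - ‖v j‖)]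
  refine hd.countable_of_isOpen (fun i _ => Metric.isOpen_ball) fun i hi => ⟨v i, ?_⟩
  exact Metric.mem_ball_self (by have := norm_pos_iff.2 (h0 i hi); positivity)

/-- `f` is a bounded measurable eigenfunction of the flow `T`, not almost everywhere zero, with
frequency `l`. -/
structure IsFlowEigenfunction {X : Type*} [MeasurableSpace X] (m : Measure X) (T : ℝ → X → X)
    (l : ℝ) (f : X → ℂ) : Prop where
  measurable : Measurable f
  bounded : ∃ C : ℝ, ∀ x, ‖f x‖ ≤ C
  ne_zero : ¬ f =ᵐ[m] 0
  map_flow : ∀ r x, f (T r x) = Complex.exp ((l * r : ℝ) * Complex.I) * f x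

namespace IsFlowEigenfunction

variable {X : Type*} [MeasurableSpace X] {m : Measure X} {T : ℝ → X → X}

theorem memLp [IsProbabilityMeasure m] {l : ℝ} {f : X → ℂ} (hf : IsFlowEigenfunction m T l f) : MemLp f 2 m := by
  obtain ⟨C, hC⟩ := hf.bounded
  exact MemLp.of_bound hf.measurable.aestronglyMeasurable C (Eventually.of_forall hC)

theorem integral_conj_mul_eq_zero (hT : ∀ t, MeasurePreserving (T t) m m) {k l : ℝ}
    (hkl : k ≠ l) {f g : X → ℂ} (hf : IsFlowEigenfunction m T k f)
    (hg : IsFlowEigenfunction m T l g) :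
    ∫ x, g x * starRingEnd ℂ (f x) ∂m = 0 := by
  set r : ℝ := Real.pi / (l - k) with hr
  have hlk : l - k ≠ 0 := sub_ne_zero.2 hkl.symm
  have hmeas : AEStronglyMeasurable (fun x => g x * starRingEnd ℂ (f x)) m :=
    (hg.measurable.mul (Complex.continuous_conj.measurable.comp
      hf.measurable)).aestronglyMeasurable
  have h1 : ∫ x, g (T r x) * starRingEnd ℂ (f (T r x)) ∂m
      = ∫ x, g x * starRingEnd ℂ (f x) ∂m := by
    have h2 := integral_map (hT r).measurable.aemeasurable ((hT r).map_eq.symm ▸ hmeas)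
    rw [(hT r).map_eq] at h2
    exact h2.symm
  have h3 : ∀ x, g (T r x) * starRingEnd ℂ (f (T r x)) = -(g x * starRingEnd ℂ (f x)) := by
    intro x
    have he : Complex.exp ((l * r : ℝ) * Complex.I)
        * starRingEnd ℂ (Complex.exp ((k * r : ℝ) * Complex.I)) = -1 := by
      rw [← Complex.exp_conj, ← Complex.exp_add, map_mul, Complex.conj_I, Complex.conj_ofReal,
        ← Complex.exp_pi_mul_I]
      congr 1
      have : l * r - k * r = Real.pi := by rw [hr]; field_simp
      rw [← this]
      push_cast
      ring
    rw [hg.map_flow, hf.map_flow, map_mul]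
    linear_combination (g x * starRingEnd ℂ (f x)) * he
  simp_rw [h3] at h1
  rw [integral_neg] at h1
  exact self_eq_neg.1 h1.symm

/-- The point spectrum of a measure-preserving flow on a separable probability space is
countable. -/
theorem countable_setOf_exists [IsProbabilityMeasure m] [IsSeparable m]
    (hT : ∀ t, MeasurePreserving (T t) m m) :
    {l : ℝ | ∃ f, IsFlowEigenfunction m T l f}.Countable := by
  classical
  choose! F hF using fun (l : ℝ) (hl : ∃ f, IsFlowEigenfunction m T l f) => hl
  let v : ℝ → Lp ℂ 2 m := fun l =>
    if h : ∃ f, IsFlowEigenfunction m T l f then (hF l h).memLp.toLp else 0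
  have : Fact ((2 : ENNReal) ≠ ⊤) := ⟨by simp⟩
  refine countable_of_pairwise_orthogonal (v := v) ?_ ?_
  · intro l hl h
    have hv : v l = (hF l hl).memLp.toLp := dif_pos hl
    rw [hv, Lp.eq_zero_iff_ae_eq_zero] at h
    exact (hF l hl).ne_zero ((hF l hl).memLp.coeFn_toLp.symm.trans h)
  · intro k hk l hl hkl
    have hvk : v k = (hF k hk).memLp.toLp := dif_pos hk
    have hvl : v l = (hF l hl).memLp.toLp := dif_pos hl
    rw [hvk, hvl, L2.inner_def, ← integral_conj_mul_eq_zero hT hkl (hF k hk) (hF l hl)]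
    refine integral_congr_ae ?_
    filter_upwards [(hF k hk).memLp.coeFn_toLp, (hF l hl).memLp.coeFn_toLp] with x h1 h2
    rw [h1, h2]
    simp

end IsFlowEigenfunction

/-- The `n`-th Fourier coefficient over the period `τ` of `φ` along the orbit of `x`. -/
noncomputable def orbitFourierCoeff {X : Type*} (T : ℝ → X → X) (τ : ℝ) (φ : X → ℂ) (n : ℤ)
    (x : X) : ℂ :=
  (1 / τ) • ∫ s in (0 : ℝ)..τ,
    Complex.exp ((-(2 * Real.pi * n / τ * s) : ℝ) * Complex.I) * φ (T s x)

section OrbitFourierCoeff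

variable {X : Type*} {T : ℝ → X → X} {τ : ℝ} {φ : X → ℂ}

theorem fourierCoeffOn_orbit (hτ : 0 < τ) (n : ℤ) (x : X) :
    fourierCoeffOn hτ (fun s => φ (T s x)) n = orbitFourierCoeff T τ φ n x := by
  rw [fourierCoeffOn_eq_integral, orbitFourierCoeff]
  simp only [sub_zero]
  congr 1
  refine intervalIntegral.integral_congr fun s _ => ?_
  simp only [fourier_coe_apply, smul_eq_mul]
  congr 2
  push_cast
  ring

theorem orbitFourierCoeff_flow (hTadd : ∀ s t : ℝ, T (t + s) = T t ∘ T s) (hτ : 0 < τ)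
    (hφ : ∀ x, φ (T τ x) = φ x) (n : ℤ) (r : ℝ) (x : X) :
    orbitFourierCoeff T τ φ n (T r x)
      = Complex.exp ((2 * Real.pi * n / τ * r : ℝ) * Complex.I)
        * orbitFourierCoeff T τ φ n x := by
  set g : ℝ → ℂ := fun s =>
    Complex.exp ((-(2 * Real.pi * n / τ * s) : ℝ) * Complex.I) * φ (T s x) with hg
  have hper : Function.Periodic g τ := by
    intro s
    simp only [hg]
    rw [add_comm s τ, hTadd s τ, Function.comp_apply, hφ]
    congr 1
    rw [Complex.exp_eq_exp_iff_exists_int]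
    refine ⟨-n, ?_⟩
    have : (τ : ℂ) ≠ 0 := by exact_mod_cast hτ.ne'
    push_cast
    field_simp
    ring
  have h1 : ∀ s, Complex.exp ((-(2 * Real.pi * n / τ * s) : ℝ) * Complex.I) * φ (T s (T r x))
      = Complex.exp ((2 * Real.pi * n / τ * r : ℝ) * Complex.I) * g (s + r) := by
    intro s
    simp only [hg]
    rw [hTadd r s, Function.comp_apply, ← mul_assoc, ← Complex.exp_add]
    congr 2
    push_cast
    ring
  unfold orbitFourierCoeff
  simp_rw [h1]
  rw [intervalIntegral.integral_const_mul, intervalIntegral.integral_comp_add_right,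
    mul_smul_comm, zero_add, add_comm τ r, hper.intervalIntegral_add_eq r 0, zero_add]

theorem norm_orbitFourierCoeff_le (hτ : 0 < τ) (hφ : ∀ x, ‖φ x‖ ≤ 1) (n : ℤ) (x : X) :
    ‖orbitFourierCoeff T τ φ n x‖ ≤ 1 := by
  have h := intervalIntegral.norm_integral_le_of_norm_le_const (a := 0) (b := τ) (C := 1)
    (f := fun s => Complex.exp ((-(2 * Real.pi * n / τ * s) : ℝ) * Complex.I) * φ (T s x))
    (fun s _ => by rw [norm_mul, Complex.norm_exp_ofReal_mul_I, one_mul]; exact hφ _)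
  rw [orbitFourierCoeff, norm_smul, Real.norm_of_nonneg (by positivity)]
  rw [sub_zero, abs_of_pos hτ, one_mul] at h
  rw [one_div_mul_eq_div]
  exact (div_le_one hτ).2 h

variable [MeasurableSpace X]

theorem measurable_orbitFourierCoeff (hTmeas : Measurable fun p : ℝ × X => T p.1 p.2)
    (hτ : 0 < τ) (hφ : Measurable φ) (n : ℤ) : Measurable (orbitFourierCoeff T τ φ n) := by
  unfold orbitFourierCoeff
  simp_rw [intervalIntegral.integral_of_le hτ.le]
  refine Measurable.const_smul (M := ℝ) ?_ _
  refine (StronglyMeasurable.integral_prod_right'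
    (f := fun p : X × ℝ => Complex.exp ((-(2 * Real.pi * n / τ * p.2) : ℝ) * Complex.I)
      * φ (T p.2 p.1)) (Measurable.stronglyMeasurable ?_)).measurable
  have h : Measurable fun p : X × ℝ => T p.2 p.1 := hTmeas.comp measurable_swap
  have := hφ.comp h
  fun_prop

end OrbitFourierCoeff

section Flow

variable {X : Type*} [MeasurableSpace X] {m : Measure X} [IsProbabilityMeasure m]
  {T : ℝ → X → X}

/-- The average of the measure of `A` along the orbit segments of length `τ` is the measure
of `A`. -/
theorem integral_orbit_average (hTmp : ∀ t : ℝ, MeasurePreserving (T t) m m)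
    (hTmeas : Measurable fun p : ℝ × X => T p.1 p.2) {τ : ℝ} (hτ : 0 < τ) {A : Set X}
    (hA : MeasurableSet A) :
    ∫ x, (τ⁻¹ * ∫ s in (0 : ℝ)..τ, A.indicator (fun _ => (1 : ℝ)) (T s x)) ∂m = m.real A := by
  have hmeas : Measurable (A.indicator (fun _ => (1 : ℝ))) := measurable_const.indicator hA
  rw [integral_const_mul]
  simp_rw [intervalIntegral.integral_of_le hτ.le]
  rw [integral_integral_swap]
  · have h1 : ∀ s, ∫ x, A.indicator (fun _ => (1 : ℝ)) (T s x) ∂m = m.real A := by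
      intro s
      have h2 := integral_map (μ := m) (hTmp s).measurable.aemeasurable
        (f := A.indicator (fun _ => (1 : ℝ))) hmeas.aestronglyMeasurable
      rw [(hTmp s).map_eq, integral_indicator_const _ hA] at h2
      rw [← h2]
      simp
    simp_rw [h1]
    simp [hτ.le]
    field_simp
  · refine Integrable.of_bound
      (hmeas.comp (hTmeas.comp measurable_swap)).aestronglyMeasurable 1
      (Eventually.of_forall fun p => ?_)
    simp only [Function.uncurry, Set.indicator]
    split_ifs <;> simp

/-- If a time `τ > 0` of an ergodic flow has a nontrivial invariant set, then the flow has an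
eigenfunction whose frequency is a nonzero multiple of `2π / τ`. -/
theorem exists_flowEigenfunction_of_invariant_set (hTadd : ∀ s t : ℝ, T (t + s) = T t ∘ T s)
    (hTmp : ∀ t : ℝ, MeasurePreserving (T t) m m)
    (hTmeas : Measurable fun p : ℝ × X => T p.1 p.2)
    (herg : ∀ A : Set X, MeasurableSet A →
      (∀ t : ℝ, m (symmDiff (T t ⁻¹' A) A) = 0) → m A = 0 ∨ m A = 1)
    {τ : ℝ} (hτ : 0 < τ) {A : Set X} (hA : MeasurableSet A) (hinv : T τ ⁻¹' A = A)
    (h0 : m A ≠ 0) (h1 : m A ≠ 1) :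
    ∃ n : ℤ, n ≠ 0 ∧ ∃ f, IsFlowEigenfunction m T (2 * Real.pi * n / τ) f := by
  classical
  set φ : X → ℂ := A.indicator fun _ => 1 with hφdef
  have hφmeas : Measurable φ := measurable_const.indicator hA
  have hφle : ∀ x, ‖φ x‖ ≤ 1 := by
    intro x
    simp only [hφdef, Set.indicator]
    split_ifs <;> simp
  have hφinv : ∀ x, φ (T τ x) = φ x := by
    intro x
    have : T τ x ∈ A ↔ x ∈ A := by rw [← Set.mem_preimage, hinv]
    simp only [hφdef, Set.indicator, this]
  set c := orbitFourierCoeff T τ φ with hc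
  by_contra! hcon
  have hz : ∀ n : ℤ, n ≠ 0 → c n =ᵐ[m] 0 := by
    intro n hn
    by_contra hne
    exact hcon n hn (c n) ⟨measurable_orbitFourierCoeff hTmeas hτ hφmeas n,
      ⟨1, norm_orbitFourierCoeff_le hτ hφle n⟩, hne,
      orbitFourierCoeff_flow hTadd hτ hφinv n⟩
  have hz' : ∀ᵐ x ∂m, ∀ n : ℤ, n ≠ 0 → c n x = 0 := by
    rw [ae_all_iff]
    intro n
    by_cases hn : n = 0
    · simp [hn]
    · filter_upwards [hz n hn] with x hx _ using hx
  set p : X → ℝ := fun x =>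
    τ⁻¹ * ∫ s in (0 : ℝ)..τ, A.indicator (fun _ => (1 : ℝ)) (T s x) with hp
  have hcp : ∀ x, c 0 x = p x := by
    intro x
    have : ∀ s, φ (T s x) = ((A.indicator (fun _ => (1 : ℝ)) (T s x) : ℝ) : ℂ) := by
      intro s
      simp only [hφdef, Set.indicator]
      split_ifs <;> simp
    simp only [hc, orbitFourierCoeff, hp, this]
    simp [intervalIntegral.integral_ofReal]
  have hpinv : ∀ r x, p (T r x) = p x := by
    intro r x
    have h := orbitFourierCoeff_flow hTadd hτ hφinv 0 r x
    rw [← hc, hcp, hcp] at h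
    simpa using h
  have hpmeas : Measurable p := by
    have : p = fun x => (c 0 x).re := by ext x; rw [hcp]; simp
    rw [this]
    exact Complex.measurable_re.comp (measurable_orbitFourierCoeff hTmeas hτ hφmeas 0)
  have hp01 : ∀ᵐ x ∂m, p x = 0 ∨ p x = 1 := by
    filter_upwards [hz'] with x hx
    have hTx : Measurable fun s => T s x := hTmeas.comp (measurable_id.prodMk measurable_const)
    have hL2 : MemLp (fun s => φ (T s x)) 2 (volume.restrict (Set.Ioc 0 τ)) :=
      MemLp.of_bound (hφmeas.comp hTx).aestronglyMeasurable 1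
        (Eventually.of_forall fun s => hφle _)
    have hsum := hasSum_sq_fourierCoeffOn hτ hL2
    simp_rw [fourierCoeffOn_orbit hτ, ← hc] at hsum
    have hsum0 := hasSum_single (f := fun n => ‖c n x‖ ^ 2) 0
      (fun n hn => by simp [hx n hn])
    have heq := hsum0.unique hsum
    have hsq : ∀ s, ‖φ (T s x)‖ ^ 2 = A.indicator (fun _ => (1 : ℝ)) (T s x) := by
      intro s
      simp only [hφdef, Set.indicator]
      split_ifs <;> simp
    simp_rw [hsq] at heq
    have heq' : p x ^ 2 = p x := by
      rw [hcp, Complex.norm_real, Real.norm_eq_abs, sq_abs] at heq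
      rw [heq]
      simp [hp]
    have : p x * (p x - 1) = 0 := by linear_combination heq'
    rcases mul_eq_zero.1 this with h | h
    · exact Or.inl h
    · exact Or.inr (sub_eq_zero.1 h)
  have hint : ∫ x, p x ∂m = m.real A := integral_orbit_average hTmp hTmeas hτ hA
  have hB : MeasurableSet {x | p x = 1} := hpmeas (measurableSet_singleton 1)
  have hBinv : ∀ t : ℝ, m (symmDiff (T t ⁻¹' {x | p x = 1}) {x | p x = 1}) = 0 := by
    intro t
    have : T t ⁻¹' {x | p x = 1} = {x | p x = 1} := by
      ext x
      simp [hpinv]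
    rw [this]
    simp
  rcases herg _ hB hBinv with h | h
  · have hp0 : p =ᵐ[m] 0 := by
      have : ∀ᵐ x ∂m, ¬ p x = 1 := by
        rw [ae_iff]
        simpa using h
      filter_upwards [hp01, this] with x h2 h3
      exact h2.resolve_right h3
    rw [integral_congr_ae hp0] at hint
    apply h0
    have : m.real A = 0 := by rw [← hint]; simp
    rwa [measureReal_eq_zero_iff] at this
  · have hp1 : p =ᵐ[m] fun _ => 1 := (prob_compl_eq_zero_iff hB).2 h
    rw [integral_congr_ae hp1] at hint
    apply h1
    have : m.real A = 1 := by rw [← hint]; simp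
    rw [← ENNReal.ofReal_toReal (measure_ne_top m A)]
    change ENNReal.ofReal (m.real A) = 1
    simp [this]

end Flow

/-- If a measure-preserving flow on a standard Borel probability space is ergodic, then
the set of times `t` for which the single map `T_t` is ergodic is uncountable. -/
theorem stmt_8 {X : Type*} [MeasurableSpace X] [StandardBorelSpace X]
    (m : Measure X) [IsProbabilityMeasure m]
    (T : ℝ → X → X)
    (hT0 : T 0 = id)
    (hTadd : ∀ s t : ℝ, T (t + s) = T t ∘ T s)
    (hTmp : ∀ t : ℝ, MeasurePreserving (T t) m m)
    (hTmeas : Measurable fun p : ℝ × X => T p.1 p.2)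
    (herg : ∀ A : Set X, MeasurableSet A →
      (∀ t : ℝ, m (symmDiff (T t ⁻¹' A) A) = 0) → m A = 0 ∨ m A = 1) :
    ¬ Set.Countable {t : ℝ | ∀ A : Set X, MeasurableSet A →
        m (symmDiff (T t ⁻¹' A) A) = 0 → m A = 0 ∨ m A = 1} := by
  intro hcount
  have hspec := IsFlowEigenfunction.countable_setOf_exists hTmp
  set S := {l : ℝ | ∃ f, IsFlowEigenfunction m T l f}
  have hbad : ({0} ∪ ⋃ n : ℤ, ((fun l : ℝ => 2 * Real.pi * n / l) '' S ∪
      (fun l : ℝ => -(2 * Real.pi * n / l)) '' S)).Countable :=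
    (Set.countable_singleton 0).union
      (Set.countable_iUnion fun n => (hspec.image _).union (hspec.image _))
  refine Set.not_countable_univ (α := ℝ) ((hcount.union hbad).mono fun t _ => ?_)
  by_contra! hcon
  simp only [Set.mem_union, Set.mem_ofPred_eq, not_or] at hcon
  obtain ⟨hne, ht0, hbad'⟩ := hcon
  push Not at hne
  obtain ⟨A, hA, hAinv, hA0, hA1⟩ := hne
  obtain ⟨B, hB, hBA, hBinv⟩ :=
    (hTmp t).quasiMeasurePreserving.exists_preimage_eq_of_preimage_ae hA.nullMeasurableSet
      (measure_symmDiff_eq_zero_iff.1 hAinv)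
  rw [← measure_congr hBA] at hA0 hA1
  have hfreq : ∀ τ : ℝ, τ ≠ 0 → ∀ n : ℤ, n ≠ 0 →
      2 * Real.pi * n / (2 * Real.pi * n / τ) = τ := by
    intro τ hτ n hn
    have : (n : ℝ) ≠ 0 := by exact_mod_cast hn
    have := Real.pi_ne_zero
    field_simp
  apply hbad'
  rcases lt_or_gt_of_ne (show t ≠ 0 from ht0) with ht | ht
  · have hBinv' : T (-t) ⁻¹' B = B := by
      conv_lhs => rw [← hBinv]
      rw [← Set.preimage_comp, ← hTadd, add_neg_cancel, hT0, Set.preimage_id]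
    obtain ⟨n, hn, hf⟩ := exists_flowEigenfunction_of_invariant_set hTadd hTmp hTmeas herg
      (neg_pos.2 ht) hB hBinv' hA0 hA1
    refine Set.mem_iUnion.2 ⟨n, Or.inr ⟨_, hf, ?_⟩⟩
    simp only [hfreq (-t) (by simpa using ht.ne) n hn, neg_neg]
  · obtain ⟨n, hn, hf⟩ := exists_flowEigenfunction_of_invariant_set hTadd hTmp hTmeas herg
      ht hB hBinv hA0 hA1
    exact Set.mem_iUnion.2 ⟨n, Or.inl ⟨_, hf, hfreq t ht.ne' n hn⟩⟩
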